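/- The model-checking problem for CCTLb±1 is undecidable: with respect to a natural encoding into ℕ of triples (S,q,Φ) consisting of a finite Kripke structure S (over atomic propositions indexed by ℕ), a state q of S and a CCTLb±1 formula Φ, the predicate 'q ⊨_S Φ' is not computable (there is no algorithm deciding it). -/

import Mathlib

open scoped Classical

noncomputable section

/-- A Kripke structure over atomic propositions indexed by `ℕ`. -/
structure Kripke (Q : Type) where
  R : Q → Q → Prop
  total : ∀ q, ∃ q', R q q'
  label : Q → ℕ → Prop

/-- An (infinite) run of a Kripke structure. -/
def Kripke.Run {Q : Type} (S : Kripke Q) (ρ : ℕ → Q) : Prop :=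
  ∀ i, S.R (ρ i) (ρ (i + 1))

/-- The strict prefix `ρ(0) ⋯ ρ(n-1)` of a run (`n` states). -/
def runPrefix {Q : Type} (ρ : ℕ → Q) (n : ℕ) : List Q :=
  (List.range n).map ρ

/-- The number of states of a finite prefix satisfying a predicate. -/
def countSat {Q : Type} (p : Q → Prop) : List Q → ℕ
  | [] => 0
  | s :: t => (if p s then 1 else 0) + countSat p t

/-- Comparison operators `<, ≤, =, ≥, >`. -/
inductive Cmp where
  | lt | le | eq | ge | gt

def Cmp.eval : Cmp → ℤ → ℤ → Prop
  | .lt, a, b => a < b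
  | .le, a, b => a ≤ b
  | .eq, a, b => a = b
  | .ge, a, b => a ≥ b
  | .gt, a, b => a > b

mutual
/-- CCTLb±1 formulas (well-formed ones have all coefficients in `{−1,1}`,
see `CForm.PM` below). -/
inductive CForm : Type where
  | atom : ℕ → CForm
  | and : CForm → CForm → CForm
  | not : CForm → CForm
  | eu : CForm → Constr → CForm → CForm
  | au : CForm → Constr → CForm → CForm

/-- Linear expressions `Σᵢ αᵢ·#φᵢ` with integer coefficients. -/
inductive LinExp : Type where
  | term : ℤ → CForm → LinExp
  | add : LinExp → LinExp → LinExp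

/-- Boolean combinations of atomic constraints `(Σᵢ αᵢ·#φᵢ) ∼ k`, `k ∈ ℤ`. -/
inductive Constr : Type where
  | atomic : LinExp → Cmp → ℤ → Constr
  | cand : Constr → Constr → Constr
  | cnot : Constr → Constr
end

mutual
/-- Satisfaction of a CCTLb±1 formula at a state. -/
def sat {Q : Type} (S : Kripke Q) : CForm → Q → Prop
  | .atom p, q => S.label q p
  | .and φ ψ, q => sat S φ q ∧ sat S ψ q
  | .not φ, q => ¬ sat S φ q
  | .eu φ C ψ, q => ∃ ρ, S.Run ρ ∧ ρ 0 = q ∧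
      ∃ i, sat S ψ (ρ i) ∧ csat S C (runPrefix ρ i) ∧ ∀ j < i, sat S φ (ρ j)
  | .au φ C ψ, q => ∀ ρ, S.Run ρ → ρ 0 = q →
      ∃ i, sat S ψ (ρ i) ∧ csat S C (runPrefix ρ i) ∧ ∀ j < i, sat S φ (ρ j)
termination_by φ _ => sizeOf φ

def lval {Q : Type} (S : Kripke Q) : LinExp → List Q → ℤ
  | .term a φ, σ => a * (countSat (fun s => sat S φ s) σ : ℤ)
  | .add e f, σ => lval S e σ + lval S f σ
termination_by e _ => sizeOf e

def csat {Q : Type} (S : Kripke Q) : Constr → List Q → Prop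
  | .atomic e c k, σ => c.eval (lval S e σ) k
  | .cand C D, σ => csat S C σ ∧ csat S D σ
  | .cnot C, σ => ¬ csat S C σ
termination_by C _ => sizeOf C
end

mutual
/-- All coefficients of the formula belong to `{−1, 1}` (CCTLb±1). -/
def CForm.PM : CForm → Prop
  | .atom _ => True
  | .and φ ψ => φ.PM ∧ ψ.PM
  | .not φ => φ.PM
  | .eu φ C ψ => φ.PM ∧ C.PM ∧ ψ.PM
  | .au φ C ψ => φ.PM ∧ C.PM ∧ ψ.PM

def LinExp.PM : LinExp → Prop
  | .term a φ => (a = 1 ∨ a = -1) ∧ φ.PM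
  | .add e f => e.PM ∧ f.PM

def Constr.PM : Constr → Prop
  | .atomic e _ _ => e.PM
  | .cand C D => C.PM ∧ D.PM
  | .cnot C => C.PM
end

mutual
/-- A natural (Gödel) encoding of formulas as natural numbers. -/
def encForm : CForm → ℕ
  | .atom p => Nat.pair 0 p
  | .and φ ψ => Nat.pair 1 (Nat.pair (encForm φ) (encForm ψ))
  | .not φ => Nat.pair 2 (encForm φ)
  | .eu φ C ψ => Nat.pair 3 (Nat.pair (encForm φ) (Nat.pair (encConstr C) (encForm ψ)))
  | .au φ C ψ => Nat.pair 4 (Nat.pair (encForm φ) (Nat.pair (encConstr C) (encForm ψ)))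

def encLin : LinExp → ℕ
  | .term a φ => Nat.pair 0 (Nat.pair (Encodable.encode a) (encForm φ))
  | .add e f => Nat.pair 1 (Nat.pair (encLin e) (encLin f))

def encConstr : Constr → ℕ
  | .atomic e c k =>
      Nat.pair 0 (Nat.pair (encLin e)
        (Nat.pair (match c with | .lt => 0 | .le => 1 | .eq => 2 | .ge => 3 | .gt => 4)
          (Encodable.encode k)))
  | .cand C D => Nat.pair 1 (Nat.pair (encConstr C) (encConstr D))
  | .cnot C => Nat.pair 2 (encConstr C)
end

/-- A finite presentation of a Kripke structure: states `0, …, n−1`, a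
list of edges and a list of (state, proposition) labelling pairs. -/
structure FinKS where
  n : ℕ
  edges : List (ℕ × ℕ)
  labels : List (ℕ × ℕ)

/-- Totality of the presented transition relation. -/
def FinKS.Total (M : FinKS) : Prop :=
  ∀ q : Fin M.n, ∃ q' : Fin M.n, ((q : ℕ), (q' : ℕ)) ∈ M.edges

/-- The Kripke structure presented by `M`. -/
def FinKS.toKripke (M : FinKS) (h : M.Total) : Kripke (Fin M.n) where
  R a b := ((a : ℕ), (b : ℕ)) ∈ M.edges
  total := h
  label a p := ((a : ℕ), p) ∈ M.labels

/-- A natural encoding of a finite Kripke structure. -/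
def encKS (M : FinKS) : ℕ :=
  Nat.pair M.n (Nat.pair (Encodable.encode M.edges) (Encodable.encode M.labels))

/-- A natural encoding of a model-checking instance `(S, q, Φ)`. -/
def encTriple (M : FinKS) (q : ℕ) (Φ : CForm) : ℕ :=
  Nat.pair (encKS M) (Nat.pair q (encForm Φ))

/-- Structured counter programs over registers indexed by `ℕ`; `loop r p` repeatedly
decrements `r` and runs `p`, until `r` is zero. -/
inductive Prog : Type where
  | skip : Prog
  | inc : ℕ → Prog
  | seq : Prog → Prog → Prog
  | loop : ℕ → Prog → Prog

namespace Prog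

open Function

/-- Big-step semantics of counter programs. -/
inductive Exec : Prog → (ℕ → ℕ) → (ℕ → ℕ) → Prop
  | skip (s : ℕ → ℕ) : Exec skip s s
  | inc (r : ℕ) (s : ℕ → ℕ) : Exec (inc r) s (update s r (s r + 1))
  | seq {p q : Prog} {s t u : ℕ → ℕ} : Exec p s t → Exec q t u → Exec (seq p q) s u
  | loop_zero {r : ℕ} {p : Prog} {s : ℕ → ℕ} : s r = 0 → Exec (loop r p) s s
  | loop_succ {r : ℕ} {p : Prog} {s t u : ℕ → ℕ} : s r ≠ 0 →
      Exec p (update s r (s r - 1)) t → Exec (loop r p) t u → Exec (loop r p) s u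

theorem exec_loop_of_invariant {r : ℕ} {p : Prog} (I : ℕ → (ℕ → ℕ) → Prop)
    (hr : ∀ m s, I m s → s r = m)
    (hp : ∀ m s, I (m + 1) s → ∃ t, Exec p (update s r m) t ∧ I m t) :
    ∀ m s, I m s → ∃ t, Exec (loop r p) s t ∧ I 0 t := by
  intro m
  induction m with
  | zero => exact fun s h => ⟨s, .loop_zero (hr _ _ h), h⟩
  | succ m ih =>
    intro s h
    obtain ⟨t, ht, hI⟩ := hp m s h
    obtain ⟨u, hu, hI0⟩ := ih t hI
    have hs := hr _ _ h
    refine ⟨u, .loop_succ (by omega) ?_ hu, hI0⟩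
    rwa [hs, Nat.add_sub_cancel]

/-- Set a register to zero. -/
def clear (r : ℕ) : Prog := loop r skip

theorem exec_clear (r : ℕ) (s : ℕ → ℕ) : Exec (clear r) s (update s r 0) := by
  obtain ⟨t, ht, hI, rfl⟩ := exec_loop_of_invariant (r := r) (p := skip)
    (fun m t => t r = m ∧ t = update s r m) (fun _ _ h => h.1)
    (fun m t h => ⟨_, .skip _, by simp, by rw [h.2]; simp⟩) (s r) s (by simp)
  exact ht

/-- Copy register `a` to register `o`, using `c` as scratch. -/
def copy (a o c : ℕ) : Prog :=
  seq (clear o) (seq (clear c) (seq (loop a (seq (inc o) (inc c))) (loop c (inc a))))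

theorem exec_copy {a o c : ℕ} (hao : a ≠ o) (hac : a ≠ c) (hoc : o ≠ c) (s : ℕ → ℕ) :
    Exec (copy a o c) s (update (update s o (s a)) c 0) := by
  obtain ⟨t, ht, h1, h2, h3, h4⟩ := exec_loop_of_invariant (r := a) (p := seq (inc o) (inc c))
    (fun m t => t a = m ∧ t o + m = s a ∧ t c + m = s a ∧
      ∀ x, x ≠ a → x ≠ o → x ≠ c → t x = s x) (fun _ _ h => h.1)
    (fun m t h => ⟨_, .seq (.inc _ _) (.inc _ _), by grind [update_apply]⟩)
    (s a) (update (update s o 0) c 0) (by grind [update_apply])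
  obtain ⟨u, hu, k1, k2, k3, k4⟩ := exec_loop_of_invariant (r := c) (p := inc a)
    (fun m t => t c = m ∧ t a + m = s a ∧ t o = s a ∧
      ∀ x, x ≠ a → x ≠ o → x ≠ c → t x = s x) (fun _ _ h => h.1)
    (fun m t h => ⟨_, .inc _ _, by grind [update_apply]⟩)
    (s a) t (by grind)
  have : u = update (update s o (s a)) c 0 := by
    funext x
    grind [update_apply]
  subst this
  exact .seq (exec_clear _ _) (.seq (exec_clear _ _) (.seq ht hu))

/-- `p` writes `f` of the registers `a i` to register `o`, and otherwise only changes
registers `≥ b`. -/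
def Computes {n : ℕ} (p : Prog) (f : List.Vector ℕ n → ℕ) (a : Fin n → ℕ) (o b : ℕ) : Prop :=
  ∀ s, ∃ t, Exec p s t ∧ t o = f (.ofFn fun i => s (a i)) ∧ ∀ x < b, x ≠ o → t x = s x

theorem exists_computes_family {m n : ℕ} (g : Fin n → List.Vector ℕ m → ℕ) (a : Fin m → ℕ)
    (b : ℕ) (ha : ∀ i, a i < b) (hg : ∀ i, ∃ p, Computes p (g i) a (b + i) (b + n)) :
    ∀ k ≤ n, ∃ p, ∀ s, ∃ t, Exec p s t ∧
      (∀ i : Fin n, i < k → t (b + i) = g i (.ofFn fun j => s (a j))) ∧ ∀ x < b, t x = s x := by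
  intro k
  induction k with
  | zero => exact fun _ => ⟨skip, fun s => ⟨s, .skip s, by simp, by simp⟩⟩
  | succ k ih =>
    intro hk
    obtain ⟨p, hp⟩ := ih (by omega)
    obtain ⟨q, hq⟩ := hg ⟨k, hk⟩
    refine ⟨seq p q, fun s => ?_⟩
    obtain ⟨t, ht, h1, h2⟩ := hp s
    obtain ⟨u, hu, k1, k2⟩ := hq t
    have hv : (fun j => t (a j)) = fun j => s (a j) := funext fun j => h2 _ (ha j)
    refine ⟨u, .seq ht hu, fun i hi => ?_, fun x hx => ?_⟩
    · rcases eq_or_ne (i : ℕ) k with h | h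
      · obtain rfl : i = ⟨k, hk⟩ := Fin.ext h
        rw [k1, hv]
      · rw [k2 _ (by omega) (by simpa using h), h1 i (by omega)]
    · rw [k2 _ (by omega) (by simp; omega), h2 _ hx]

theorem exists_computes_prec {n : ℕ} {f : List.Vector ℕ n → ℕ} {g : List.Vector ℕ (n + 2) → ℕ}
    {a : Fin (n + 1) → ℕ} {o b : ℕ} {pf pg : Prog} (ha : ∀ i, a i < b) (ho : o < b)
    (hf : Computes pf f (fun i => a i.succ) (b + 2) (b + 4))
    (hg : Computes pg g (Fin.cons (b + 1) (Fin.cons (b + 2) fun i => a i.succ)) (b + 3) (b + 4)) :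
    ∃ p, Computes p (fun v : List.Vector ℕ (n + 1) =>
      v.head.rec (f v.tail) fun y IH => g (y ::ᵥ IH ::ᵥ v.tail)) a o b := by
  refine ⟨seq (copy (a 0) b (b + 3)) (seq (clear (b + 1)) (seq pf (seq
    (loop b (seq pg (seq (copy (b + 3) (b + 2) (b + 4)) (inc (b + 1)))))
    (copy (b + 2) o (b + 3))))), fun s => ?_⟩
  have ha0 := ha 0
  set w : List.Vector ℕ n := .ofFn fun i => s (a i.succ) with hw
  set F : ℕ → ℕ := fun m => m.rec (f w) fun y IH => g (y ::ᵥ IH ::ᵥ w) with hF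
  have hrec : ∀ m, F (m + 1) = g (m ::ᵥ F m ::ᵥ w) := fun m => rfl
  have e1 := exec_copy (a := a 0) (o := b) (c := b + 3) (by omega) (by omega) (by omega) s
  have e2 := exec_clear (b + 1) (update (update s b (s (a 0))) (b + 3) 0)
  obtain ⟨t, ht, h1, h2⟩ := hf (update (update (update s b (s (a 0))) (b + 3) 0) (b + 1) 0)
  have hfw : t (b + 2) = F 0 := by
    rw [h1]
    show _ = f w
    rw [hw]
    congr 2
    funext i
    have := ha i.succ
    grind [update_apply]
  obtain ⟨u, hu, k1, k2, k3, k4⟩ := exec_loop_of_invariant (r := b)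
    (p := seq pg (seq (copy (b + 3) (b + 2) (b + 4)) (inc (b + 1))))
    (fun m t => t b = m ∧ t (b + 1) + m = s (a 0) ∧ t (b + 2) = F (t (b + 1)) ∧
      ∀ x < b, t x = s x) (fun _ _ h => h.1)
    (fun m t ⟨j1, j2, j3, j4⟩ => by
      obtain ⟨u, hu, i1, i2⟩ := hg (update t b m)
      refine ⟨_, .seq hu (.seq (exec_copy (by omega) (by omega) (by omega) u) (.inc _ _)), ?_⟩
      have hu1 : u (b + 1) = t (b + 1) := by
        rw [i2 _ (by omega) (by omega)]; simp
      have hub : u b = m := by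
        rw [i2 _ (by omega) (by omega)]; simp
      have hu3 : u (b + 3) = F (t (b + 1) + 1) := by
        rw [i1, hrec, ← j3]
        congr 1
        rw [List.Vector.ofFn, List.Vector.ofFn]
        simp only [Fin.cons_zero, Fin.cons_succ]
        have q1 : update t b m (b + 1) = t (b + 1) := by simp
        have q2 : update t b m (b + 2) = t (b + 2) := by simp
        have q3 : (fun i => update t b m (a (Fin.succ i))) = fun i => s (a i.succ) := by
          funext i
          have := ha i.succ
          rw [update_of_ne (by omega), j4 _ this]
        rw [q1, q2, q3]
      have hux : ∀ x < b, u x = s x := fun x hx => by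
        rw [i2 _ (by omega) (by omega), update_of_ne (by omega), j4 x hx]
      clear_value F
      refine ⟨?_, ?_, ?_, ?_⟩ <;> grind [update_apply])
    (s (a 0)) t (by
      have q0 : t b = s (a 0) := by rw [h2 _ (by omega) (by omega)]; simp
      have q1 : t (b + 1) = 0 := by rw [h2 _ (by omega) (by omega)]; simp
      refine ⟨q0, by omega, by rw [q1, hfw], fun x hx => ?_⟩
      rw [h2 _ (by omega) (by omega)]
      grind [update_apply])
  refine ⟨_, .seq e1 (.seq e2 (.seq ht (.seq hu
    (exec_copy (by omega) (by omega) (by omega) u)))), ?_, ?_⟩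
  · have q : u (b + 1) = s (a 0) := by omega
    rw [update_of_ne (by omega), update_self, k3, q, hF]
    simp [hw, List.Vector.ofFn]
  · intro x hx hxo
    rw [update_of_ne (by omega), update_of_ne hxo, k4 x hx]

theorem exists_computes {n : ℕ} {f : List.Vector ℕ n → ℕ} (hf : Nat.Primrec' f) :
    ∀ (a : Fin n → ℕ) (o b : ℕ), (∀ i, a i < b) → o < b → (∀ i, a i ≠ o) →
      ∃ p, Computes p f a o b := by
  induction hf with
  | zero =>
    exact fun a o b _ _ _ => ⟨clear o, fun s => ⟨_, exec_clear o s, by simp, by simp_all⟩⟩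
  | succ =>
    intro a o b ha ho hao
    refine ⟨seq (copy (a 0) o b) (inc o), fun s => ?_⟩
    have := ha 0
    refine ⟨_, .seq (exec_copy (hao 0) (by omega) (by omega) s) (.inc _ _), ?_, ?_⟩
    · simp [List.Vector.ofFn, update_of_ne (show o ≠ b by omega)]
    · grind [update_apply]
  | get i =>
    intro a o b ha ho hao
    have := ha i
    refine ⟨copy (a i) o b, fun s => ⟨_, exec_copy (hao i) (by omega) (by omega) s, ?_, ?_⟩⟩
    · simp [update_of_ne (show o ≠ b by omega)]
    · grind [update_apply]
  | @comp m n f g _ _ ihf ihg =>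
    intro a o b ha ho hao
    obtain ⟨p, hp⟩ := exists_computes_family g a b ha
      (fun i => ihg i a (b + i) (b + n) (fun j => by have := ha j; omega) (by omega)
        (fun j => by have := ha j; omega)) n le_rfl
    obtain ⟨q, hq⟩ := ihf (fun i => b + i) o (b + n) (fun i => by omega) (by omega)
      (fun i => by omega)
    refine ⟨seq p q, fun s => ?_⟩
    obtain ⟨t, ht, h1, h2⟩ := hp s
    obtain ⟨u, hu, k1, k2⟩ := hq t
    refine ⟨u, .seq ht hu, ?_, fun x hx hxo => by rw [k2 _ (by omega) hxo, h2 _ hx]⟩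
    rw [k1]
    congr 2
    funext i
    exact h1 i i.2
  | @prec n f g _ _ ihf ihg =>
    intro a o b ha ho _
    obtain ⟨pf, hf⟩ := ihf (fun i => a i.succ) (b + 2) (b + 4)
      (fun i => by have := ha i.succ; omega) (by omega) (fun i => by have := ha i.succ; omega)
    obtain ⟨pg, hg⟩ := ihg (Fin.cons (b + 1) (Fin.cons (b + 2) fun i => a i.succ)) (b + 3) (b + 4)
      (fun i => by
        refine Fin.cases (by simp) (fun i => Fin.cases (by simp) (fun i => ?_) i) i
        have := ha i.succ
        simp only [Fin.cons_succ]
        omega)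
      (by omega)
      (fun i => by
        refine Fin.cases (by simp) (fun i => Fin.cases (by simp) (fun i => ?_) i) i
        have := ha i.succ
        simp only [Fin.cons_succ]
        omega)
    exact exists_computes_prec ha ho hf hg

/-- Elementary effects on the registers. -/
inductive Act : Type where
  | nop : Act
  | halt : Act
  | inc : ℕ → Act
  | dec : ℕ → Act
  | zero : ℕ → Act

/-- Effect of an elementary action; `zero r` is an assertion and changes nothing. -/
def Act.apply : Act → (ℕ → ℕ) → ℕ → ℕ
  | .inc r, s => update s r (s r + 1)
  | .dec r, s => update s r (s r - 1)
  | _, s => s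

/-- The action performed with the given continuation, where the boolean guesses
the outcome of a zero test. -/
def act : List Prog → Bool → Act
  | [], _ => .halt
  | .inc r :: _, _ => .inc r
  | .loop r _ :: _, true => .zero r
  | .loop r _ :: _, false => .dec r
  | _, _ => .nop

/-- The next continuation, where the boolean guesses the outcome of a zero test. -/
def next : List Prog → Bool → List Prog
  | [], _ => []
  | .skip :: K, _ => K
  | .inc _ :: K, _ => K
  | .seq p q :: K, _ => p :: q :: K
  | .loop _ _ :: K, true => K
  | .loop r p :: K, false => p :: .loop r p :: K

/-- The correct guess of the zero test. -/
def honest : List Prog → (ℕ → ℕ) → Bool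
  | .loop r _ :: _, s => decide (s r = 0)
  | _, _ => true

/-- Small-step semantics of counter programs. -/
def step (c : List Prog × (ℕ → ℕ)) : List Prog × (ℕ → ℕ) :=
  (next c.1 (honest c.1 c.2), (act c.1 (honest c.1 c.2)).apply c.2)

/-- Termination of a program in the small-step semantics. -/
def Halts (p : Prog) (s : ℕ → ℕ) : Prop :=
  ∃ T, (step^[T] ([p], s)).1 = []

theorem Exec.iterate_step {p : Prog} {s t : ℕ → ℕ} (h : Exec p s t) :
    ∀ K, ∃ T, step^[T] (p :: K, s) = (K, t) := by
  induction h with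
  | skip s => exact fun K => ⟨1, rfl⟩
  | inc r s => exact fun K => ⟨1, rfl⟩
  | seq _ _ ih1 ih2 =>
    intro K
    obtain ⟨m, hm⟩ := ih1 (_ :: K)
    obtain ⟨n, hn⟩ := ih2 K
    refine ⟨n + (m + 1), ?_⟩
    rw [iterate_add_apply, iterate_succ_apply]
    exact (congrArg _ hm).trans hn
  | loop_zero h => exact fun K => ⟨1, by simp [step, honest, act, next, Act.apply, h]⟩
  | @loop_succ r p s t u h _ _ ih1 ih2 =>
    intro K
    obtain ⟨m, hm⟩ := ih1 (loop r p :: K)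
    obtain ⟨n, hn⟩ := ih2 K
    refine ⟨n + (m + 1), ?_⟩
    have : step (loop r p :: K, s) = (p :: loop r p :: K, update s r (s r - 1)) := by
      simp [step, honest, act, next, Act.apply, h]
    rw [iterate_add_apply, iterate_succ_apply, this, hm, hn]

theorem iterate_step_nil (s : ℕ → ℕ) (T : ℕ) : step^[T] ([], s) = ([], s) :=
  iterate_fixed rfl T

/-- Every zero set of a primitive recursive function projects to the halting set of a program. -/
theorem exists_halts_iff {g : ℕ → ℕ → ℕ} (hg : Primrec₂ g) :
    ∃ p, (∀ s, honest [p] s = true) ∧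
      ∀ n, Halts p (update 0 0 n) ↔ ∃ k, g n k = 0 := by
  obtain ⟨P, hP⟩ := exists_computes (Nat.Primrec'.prim_iff₂.2 hg) (fun i => i) 2 3
    (fun i => by omega) (by omega) (fun i => by omega)
  set body := seq P (inc 1)
  have hiter : ∀ s K, s 2 ≠ 0 → ∃ T t, step^[T + 1] (loop 2 body :: K, s) = (loop 2 body :: K, t) ∧
      t 0 = s 0 ∧ t 1 = s 1 + 1 ∧ t 2 = g (s 0) (s 1) := by
    intro s K hs
    obtain ⟨t, ht, h1, h2⟩ := hP (update s 2 (s 2 - 1))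
    obtain ⟨T, hT⟩ := (Exec.seq ht (.inc 1 t)).iterate_step (loop 2 body :: K)
    refine ⟨T, update t 1 (t 1 + 1), ?_, ?_⟩
    · have : step (loop 2 body :: K, s) = (body :: loop 2 body :: K, update s 2 (s 2 - 1)) := by
        simp [step, honest, act, next, Act.apply, hs]
      rw [iterate_succ_apply, this, hT]
    · have h20 := h2 0 (by omega) (by omega)
      have h21 := h2 1 (by omega) (by omega)
      simp [List.Vector.ofFn] at h1
      simp [h20, h21, h1]
  refine ⟨seq (inc 2) (loop 2 body), fun _ => rfl, fun n => ?_⟩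
  have hreach : ∀ k, (∀ j < k, g n j ≠ 0) → ∃ T ≥ k, ∃ s,
      step^[T] ([seq (inc 2) (loop 2 body)], update 0 0 n) = ([loop 2 body], s) ∧
      s 0 = n ∧ s 1 = k ∧ s 2 ≠ 0 := by
    intro k
    induction k with
    | zero =>
      exact fun _ => ⟨2, by omega, update (update 0 0 n) 2 1, rfl, rfl, rfl, by simp⟩
    | succ k ih =>
      intro hk
      obtain ⟨T, hTk, s, hT, h0, h1, h2⟩ := ih fun j hj => hk j (by omega)
      obtain ⟨T', t, hT', k0, k1, k2⟩ := hiter s [] h2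
      refine ⟨(T' + 1) + T, by omega, t, ?_, by omega, by omega, ?_⟩
      · rw [iterate_add_apply, hT, hT']
      · rw [k2, h0, h1]
        exact hk k (by omega)
  constructor
  · rintro ⟨T, hT⟩
    by_contra! h
    obtain ⟨T', hTT, s, hs, -⟩ := hreach T fun j _ => h j
    obtain ⟨d, rfl⟩ := Nat.exists_eq_add_of_le' hTT
    rw [iterate_add_apply, ← Prod.mk.eta (p := step^[T] _), hT, iterate_step_nil] at hs
    simp at hs
  · intro h
    obtain ⟨T, -, s, hs, h0, h1, h2⟩ := hreach (Nat.find h) fun j hj => Nat.find_min h hj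
    obtain ⟨T', t, hT', -, -, k2⟩ := hiter s [] h2
    rw [h0, h1, Nat.find_spec h] at k2
    refine ⟨1 + ((T' + 1) + T), ?_⟩
    rw [iterate_add_apply, iterate_add_apply, hs, hT']
    simp [step, honest, next, k2]

/-- The continuations that occur while `p` runs with continuation `K`. -/
def conts : Prog → List Prog → Set (List Prog)
  | skip, K => {skip :: K}
  | inc r, K => {inc r :: K}
  | seq p q, K => insert (seq p q :: K) (conts p (q :: K) ∪ conts q K)
  | loop r p, K => insert (loop r p :: K) (conts p (loop r p :: K))

theorem finite_conts (p : Prog) : ∀ K, (conts p K).Finite := by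
  induction p with
  | skip => exact fun K => Set.finite_singleton _
  | inc => exact fun K => Set.finite_singleton _
  | seq p q ihp ihq => exact fun K => ((ihp _).union (ihq _)).insert _
  | loop r p ih => exact fun K => (ih _).insert _

theorem cons_mem_conts (p : Prog) (K : List Prog) : p :: K ∈ conts p K := by
  cases p <;> simp [conts]

theorem next_mem_conts (p : Prog) (b : Bool) :
    ∀ K, ∀ u ∈ conts p K, next u b ∈ conts p K ∨ next u b = K := by
  induction p with
  | skip => rintro K u rfl; exact .inr rfl
  | inc => rintro K u rfl; exact .inr rfl
  | seq p q ihp ihq =>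
    rintro K u (rfl | h | h)
    · exact .inl (.inr (.inl (cons_mem_conts _ _)))
    · rcases ihp _ _ h with h | h
      · exact .inl (.inr (.inl h))
      · exact .inl (.inr (.inr (h ▸ cons_mem_conts _ _)))
    · exact (ihq _ _ h).imp (fun h => .inr (.inr h)) id
  | loop r p ih =>
    rintro K u (rfl | h)
    · cases b
      · exact .inl (.inr (cons_mem_conts _ _))
      · exact .inr rfl
    · rcases ih _ _ h with h | h
      · exact .inl (.inr h)
      · exact .inl (.inl h)

/-- The control states of the program `p`. -/
def Ctrl (p : Prog) : Set (List Prog) := insert [] (conts p [])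

theorem next_mem_ctrl {p : Prog} {u : List Prog} (hu : u ∈ Ctrl p) (b : Bool) :
    next u b ∈ Ctrl p := by
  rcases hu with rfl | hu
  · exact .inl rfl
  · exact (next_mem_conts p b _ u hu).symm

theorem self_mem_ctrl (p : Prog) : [p] ∈ Ctrl p := .inr (cons_mem_conts p [])

instance (p : Prog) : Finite (Ctrl p) := ((finite_conts p []).insert _).to_subtype

/-- The action performed at a guessed control state. -/
def actAt (y : List Prog × Bool) : Act := act y.1 y.2

/-- The sequence `y` of guessed control states reveals an error (a negative register, or a wrong
positive answer to a zero test in the last step) or a halting state among its first `i` entries. -/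
def Stops (y : ℕ → List Prog × Bool) (s : ℕ → ℕ) (i : ℕ) : Prop :=
  (∃ j < i, actAt (y j) = .halt) ∨
    ∃ r, s r + Nat.count (fun j => actAt (y j) = .inc r) i
          < Nat.count (fun j => actAt (y j) = .dec r) i ∨
      (∃ j, i = j + 1 ∧ actAt (y j) = .zero r) ∧
        Nat.count (fun j => actAt (y j) = .dec r) i
          < s r + Nat.count (fun j => actAt (y j) = .inc r) i

/-- `y` is a sequence of guessed control states of `p`. -/
def IsGuess (p : Prog) (y : ℕ → List Prog × Bool) : Prop :=
  y 0 = ([p], true) ∧ ∀ i, (y (i + 1)).1 = next (y i).1 (y i).2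

theorem act_eq_halt {u : List Prog} {b : Bool} : act u b = .halt ↔ u = [] := by
  rcases u with _ | ⟨p, K⟩
  · simp [act]
  · cases p <;> cases b <;> simp [act]

theorem act_eq_zero {u : List Prog} {b : Bool} {r : ℕ} :
    act u b = .zero r ↔ (∃ p K, u = loop r p :: K) ∧ b = true := by
  rcases u with _ | ⟨p, K⟩
  · simp [act]
  · cases p <;> cases b <;> simp [act]

theorem act_eq_dec {u : List Prog} {b : Bool} {r : ℕ} :
    act u b = .dec r ↔ (∃ p K, u = loop r p :: K) ∧ b = false := by
  rcases u with _ | ⟨p, K⟩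
  · simp [act]
  · cases p <;> cases b <;> simp [act]

theorem act_of_not_loop {u : List Prog} (h : ∀ r p K, u ≠ loop r p :: K) (b b' : Bool) :
    act u b = act u b' ∧ next u b = next u b' := by
  rcases u with _ | ⟨p, K⟩
  · simp [act, next]
  · cases p <;> simp_all [act, next]

theorem Act.apply_balance (a : Act) (s : ℕ → ℕ) (r : ℕ) (h : a = .dec r → s r ≠ 0) :
    a.apply s r + (if a = .dec r then 1 else 0) = s r + if a = .inc r then 1 else 0 := by
  cases a with
  | dec x =>
    by_cases hx : x = r
    · subst hx
      have := h rfl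
      simp [Act.apply]
      omega
    · simp [Act.apply, hx, update_of_ne (Ne.symm hx)]
  | inc x =>
    by_cases hx : x = r
    · subst hx
      simp [Act.apply]
    · simp [Act.apply, hx, update_of_ne (Ne.symm hx)]
  | _ => simp [Act.apply]

theorem act_honest_dec {u : List Prog} {s : ℕ → ℕ} {r : ℕ} (h : act u (honest u s) = .dec r) :
    s r ≠ 0 := by
  obtain ⟨⟨p, K, rfl⟩, hb⟩ := act_eq_dec.1 h
  simpa [honest] using hb

theorem act_honest_zero {u : List Prog} {s : ℕ → ℕ} {r : ℕ} (h : act u (honest u s) = .zero r) :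
    s r = 0 := by
  obtain ⟨⟨p, K, rfl⟩, hb⟩ := act_eq_zero.1 h
  simpa [honest] using hb

/-- Without a revealed error, a guessed sequence follows the computation. -/
theorem IsGuess.eq_iterate {p : Prog} {y : ℕ → List Prog × Bool} {s : ℕ → ℕ} (hy : IsGuess p y)
    (hs : ∀ i, ¬ Stops y s i) (i : ℕ) :
    (y i).1 = (step^[i] ([p], s)).1 ∧
      ∀ r, (step^[i] ([p], s)).2 r + Nat.count (fun j => actAt (y j) = .dec r) i =
        s r + Nat.count (fun j => actAt (y j) = .inc r) i := by
  induction i with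
  | zero => simp [hy.1]
  | succ i ih =>
    obtain ⟨ih1, ih2⟩ := ih
    rw [iterate_succ_apply']
    generalize step^[i] ([p], s) = c at *
    obtain ⟨u, t⟩ := c
    simp only at ih1 ih2
    have key : act (y i).1 (y i).2 = act u (honest u t) ∧
        next (y i).1 (y i).2 = next u (honest u t) := by
      rw [ih1]
      by_cases hl : ∃ r p K, u = loop r p :: K
      · obtain ⟨r, p, K, hu⟩ := hl
        suffices h : (y i).2 = honest u t by simp [h]
        have hno_error := hs (i + 1)
        have := ih2 r
        rw [Stops, not_or] at hno_error
        have hr := not_exists.1 hno_error.2 r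
        rw [Nat.count_succ, Nat.count_succ] at hr
        rcases hb : (y i).2 with _ | _
        · have hact : actAt (y i) = .dec r := act_eq_dec.2 ⟨⟨p, K, by rw [ih1, hu]⟩, hb⟩
          simp only [hact, reduceCtorEq, if_true, if_false, not_or] at hr
          rw [hu]
          simp only [honest]
          exact (decide_eq_false (by omega)).symm
        · have hact : actAt (y i) = .zero r := act_eq_zero.2 ⟨⟨p, K, by rw [ih1, hu]⟩, hb⟩
          simp only [hact, reduceCtorEq, if_false, not_or, not_and] at hr
          have := hr.2 ⟨i, rfl, hact⟩
          rw [hu]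
          simp only [honest]
          exact (decide_eq_true (by omega)).symm
      · push Not at hl
        exact act_of_not_loop hl _ _
    refine ⟨(hy.2 i).trans key.2, fun r => ?_⟩
    have hb := (act u (honest u t)).apply_balance t r act_honest_dec
    have := ih2 r
    have hact : actAt (y i) = act u (honest u t) := key.1
    rw [Nat.count_succ, Nat.count_succ, hact]
    simp only [step]
    omega

theorem halts_iff_forall_isGuess {p : Prog} (hp : ∀ s, honest [p] s = true) (s : ℕ → ℕ) :
    Halts p s ↔ ∀ y, IsGuess p y → ∃ i, Stops y s i := by
  constructor
  · rintro ⟨T, hT⟩ y hy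
    by_contra! h
    have := (hy.eq_iterate h T).1.trans hT
    exact h (T + 1) (.inl ⟨T, by omega, act_eq_halt.2 this⟩)
  · intro h
    by_contra hh
    set c : ℕ → List Prog × (ℕ → ℕ) := fun i => step^[i] ([p], s) with hc
    have hsucc : ∀ i, c (i + 1) = step (c i) := fun i => iterate_succ_apply' _ _ _
    set y : ℕ → List Prog × Bool := fun i => ((c i).1, honest (c i).1 (c i).2) with hydef
    have hy : IsGuess p y := ⟨Prod.ext rfl (hp s), fun i => by simp [hydef, hsucc, step]⟩
    have hbal : ∀ i r, (c i).2 r + Nat.count (fun j => actAt (y j) = .dec r) i =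
        s r + Nat.count (fun j => actAt (y j) = .inc r) i := by
      intro i r
      induction i with
      | zero => simp [hc]
      | succ i ih =>
        have hb := (actAt (y i)).apply_balance (c i).2 r act_honest_dec
        have : (c (i + 1)).2 = (actAt (y i)).apply (c i).2 := by rw [hsucc]; rfl
        rw [Nat.count_succ, Nat.count_succ, this]
        omega
    obtain ⟨i, ⟨j, -, hj⟩ | ⟨r, hr | ⟨⟨j, rfl, hj⟩, hr⟩⟩⟩ := h y hy
    · exact hh ⟨j, act_eq_halt.1 hj⟩
    · have := hbal i r
      omega
    · have := hbal (j + 1) r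
      have hz : (c j).2 r = 0 := act_honest_zero hj
      have : (c (j + 1)).2 r = 0 := by
        have h1 : (c (j + 1)).2 = (actAt (y j)).apply (c j).2 := by rw [hsucc]; rfl
        rw [h1, hj]
        exact hz
      omega

/-- Guessed sequences stay among the control states. -/
theorem IsGuess.mem_ctrl {p : Prog} {y : ℕ → List Prog × Bool} (hy : IsGuess p y) (i : ℕ) :
    (y i).1 ∈ Ctrl p := by
  induction i with
  | zero => rw [hy.1]; exact self_mem_ctrl p
  | succ i ih => rw [hy.2]; exact next_mem_ctrl ih _

end Prog

section Formula

/-- A formula that always holds. -/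
def CForm.top : CForm := .not (.and (.atom 0) (.not (.atom 0)))

/-- Disjunction of constraints. -/
def Constr.or (C D : Constr) : Constr := .cnot (.cand (.cnot C) (.cnot D))

/-- The difference between the numbers of states labelled `i` and `j`. -/
def LinExp.diff (i j : ℕ) : LinExp := .add (.term 1 (.atom i)) (.term (-1) (.atom j))

/-- With increments, decrements, zero assertions and zero assertions of the previous state
labelled `4 * r + 1`, …, `4 * r + 4`, and initial value `k`: register `r` is negative or
the last state falsely asserts that it is zero. -/
def Constr.wrong (r k : ℕ) : Constr :=
  .or (.atomic (.diff (4 * r + 2) (4 * r + 1)) .gt k)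
    (.cand (.atomic (.diff (4 * r + 3) (4 * r + 4)) .ge 1)
      (.atomic (.diff (4 * r + 2) (4 * r + 1)) .lt k))

/-- Either a state labelled `0` has been visited, or some register `r < R` is wrong. -/
def Constr.stops (s : ℕ → ℕ) : ℕ → Constr
  | 0 => .atomic (.term 1 (.atom 0)) .ge 1
  | R + 1 => .or (.wrong R (s R)) (.stops s R)

/-- Every run reveals an error or a halting state. -/
def CForm.stops (s : ℕ → ℕ) (R : ℕ) : CForm := .au .top (.stops s R) .top

theorem CForm.stops_pm (s : ℕ → ℕ) (R : ℕ) : (CForm.stops s R).PM := by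
  have h : (Constr.stops s R).PM := by
    induction R with
    | zero => simp [Constr.stops, Constr.PM, LinExp.PM, CForm.PM]
    | succ R ih =>
      simp [Constr.stops, Constr.or, Constr.wrong, LinExp.diff, Constr.PM, LinExp.PM, CForm.PM, ih]
  simp [CForm.stops, CForm.top, CForm.PM, h]

theorem csat_or {Q : Type} (S : Kripke Q) (C D : Constr) (σ : List Q) :
    csat S (.or C D) σ ↔ csat S C σ ∨ csat S D σ := by
  simp only [Constr.or, csat]
  tauto

theorem csat_wrong {Q : Type} (S : Kripke Q) (r k : ℕ) (σ : List Q) :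
    csat S (.wrong r k) σ ↔
      k + countSat (S.label · (4 * r + 1)) σ < countSat (S.label · (4 * r + 2)) σ ∨
      countSat (S.label · (4 * r + 4)) σ < countSat (S.label · (4 * r + 3)) σ ∧
        countSat (S.label · (4 * r + 2)) σ < k + countSat (S.label · (4 * r + 1)) σ := by
  simp only [Constr.wrong, csat_or, LinExp.diff, csat, lval, sat, Cmp.eval]
  omega

theorem csat_stops {Q : Type} (S : Kripke Q) (s : ℕ → ℕ) (R : ℕ) (σ : List Q) :
    csat S (.stops s R) σ ↔ 0 < countSat (S.label · 0) σ ∨ ∃ r < R,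
      s r + countSat (S.label · (4 * r + 1)) σ < countSat (S.label · (4 * r + 2)) σ ∨
      countSat (S.label · (4 * r + 4)) σ < countSat (S.label · (4 * r + 3)) σ ∧
        countSat (S.label · (4 * r + 2)) σ < s r + countSat (S.label · (4 * r + 1)) σ := by
  induction R with
  | zero =>
    simp only [Constr.stops, csat, lval, sat, Cmp.eval, Nat.not_lt_zero, false_and, exists_false,
      or_false]
    omega
  | succ R ih =>
    rw [Constr.stops, csat_or, csat_wrong, ih, Nat.exists_lt_succ_right]
    exact or_comm.trans or_assoc

theorem sat_stops {Q : Type} (S : Kripke Q) (s : ℕ → ℕ) (R : ℕ) (q : Q) :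
    sat S (.stops s R) q ↔
      ∀ ρ, S.Run ρ → ρ 0 = q → ∃ i, csat S (.stops s R) (runPrefix ρ i) := by
  simp [CForm.stops, CForm.top, sat]

theorem countSat_runPrefix {Q : Type} (P : Q → Prop) (ρ : ℕ → Q) (i : ℕ) :
    countSat P (runPrefix ρ i) = Nat.count (fun j => P (ρ j)) i := by
  have happ : ∀ σ τ : List Q, countSat P (σ ++ τ) = countSat P σ + countSat P τ := by
    intro σ τ
    induction σ with
    | nil => simp [countSat]
    | cons a σ ih => simp [countSat, ih, add_assoc]
  induction i with
  | zero => rfl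
  | succ i ih =>
    have : runPrefix ρ (i + 1) = runPrefix ρ i ++ [ρ i] := by simp [runPrefix, List.range_succ]
    rw [this, happ, ih, Nat.count_succ]
    simp [countSat]

theorem computable_encTriple_stops (M : FinKS) (q R : ℕ) :
    Computable fun n => encTriple M q (.stops (Function.update 0 0 n) R) := by
  have hcast : ∀ r, Primrec fun n : ℕ =>
      Encodable.encode ((Function.update (0 : ℕ → ℕ) 0 n r : ℕ) : ℤ) := by
    intro r
    have h2 : ∀ k : ℕ, Encodable.encode (k : ℤ) = 2 * k := fun k => rfl
    simp only [h2]
    refine Primrec.nat_mul.comp (.const 2) ?_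
    by_cases hr : r = 0
    · simp only [hr, Function.update_self]
      exact Primrec.id
    · simpa [hr] using Primrec.const 0
  have hp : ∀ {f g : ℕ → ℕ}, Primrec f → Primrec g → Primrec fun n => Nat.pair (f n) (g n) :=
    fun hf hg => Primrec₂.natPair.comp hf hg
  have hatomic : ∀ e c (k : ℕ → ℤ), Primrec (fun n => Encodable.encode (k n)) →
      Primrec fun n => encConstr (.atomic e c (k n)) := fun e c k hk => by
    simp only [encConstr]
    exact hp (.const _) (hp (.const _) (hp (.const _) hk))
  have hnot : ∀ C : ℕ → Constr, Primrec (fun n => encConstr (C n)) →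
      Primrec fun n => encConstr (.cnot (C n)) := fun C hC => by
    simp only [encConstr]
    exact hp (.const _) hC
  have hand : ∀ C D : ℕ → Constr, Primrec (fun n => encConstr (C n)) →
      Primrec (fun n => encConstr (D n)) → Primrec fun n => encConstr (.cand (C n) (D n)) :=
    fun C D hC hD => by
      simp only [encConstr]
      exact hp (.const _) (hp hC hD)
  have hor : ∀ C D : ℕ → Constr, Primrec (fun n => encConstr (C n)) →
      Primrec (fun n => encConstr (D n)) → Primrec fun n => encConstr (.or (C n) (D n)) :=
    fun C D hC hD => hnot _ (hand _ _ (hnot _ hC) (hnot _ hD))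
  have hC : Primrec fun n => encConstr (.stops (Function.update 0 0 n) R) := by
    induction R with
    | zero => exact .const _
    | succ R ih =>
      exact hor _ _ (hor _ _ (hatomic _ _ _ (hcast R))
        (hand _ _ (.const _) (hatomic _ _ _ (hcast R)))) ih
  refine Primrec.to_comp ?_
  simp only [encTriple, CForm.stops, encForm]
  exact hp (.const _) (hp (.const _) (hp (.const _) (hp (.const _) (hp hC (.const _)))))

/-- Every total relation on a finite type, with finitely many of its labels, has a finite
presentation. -/
theorem exists_finKS {V : Type} [Finite V] (E : V → V → Prop) (hE : ∀ v, ∃ w, E v w)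
    (lab : V → ℕ → Prop) (B : ℕ) :
    ∃ (M : FinKS) (hM : M.Total) (e : Fin M.n ≃ V),
      (∀ a b, (M.toKripke hM).R a b ↔ E (e a) (e b)) ∧
      ∀ a, ∀ x < B, (M.toKripke hM).label a x ↔ lab (e a) x := by
  obtain ⟨n, ⟨e'⟩⟩ := Finite.exists_equiv_fin V
  set e := e'.symm
  let M : FinKS :=
    { n := n
      edges := (List.range n ×ˢ List.range n).filter fun x =>
        ∃ (h : x.1 < n) (h' : x.2 < n), E (e ⟨x.1, h⟩) (e ⟨x.2, h'⟩)
      labels := (List.range n ×ˢ List.range B).filter fun x =>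
        ∃ h : x.1 < n, lab (e ⟨x.1, h⟩) x.2 }
  have hedge : ∀ a b : Fin n, ((a : ℕ), (b : ℕ)) ∈ M.edges ↔ E (e a) (e b) := by
    intro a b
    simp [M]
  have hlab : ∀ a : Fin n, ∀ x < B, ((a : ℕ), x) ∈ M.labels ↔ lab (e a) x := by
    intro a x hx
    simp [M, hx]
  refine ⟨M, fun a => ?_, e, hedge, hlab⟩
  obtain ⟨w, hw⟩ := hE (e a)
  exact ⟨e.symm w, (hedge _ _).2 (by simpa using hw)⟩

end Formula

namespace Prog

open Function

/-- A guessed control state together with its predecessor. -/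
abbrev Node (p : Prog) : Type := (Ctrl p × Bool) × (Ctrl p × Bool)

/-- The transitions between nodes. -/
def Node.Edge {p : Prog} (v w : Node p) : Prop :=
  w.1 = v.2 ∧ (w.2.1 : List Prog) = next v.2.1 v.2.2

theorem Node.edge_total {p : Prog} (v : Node p) : ∃ w, Node.Edge v w :=
  ⟨(v.2, (⟨_, next_mem_ctrl v.2.1.2 v.2.2⟩, true)), rfl, rfl⟩

/-- The atomic propositions holding at a node. -/
def Node.lab {p : Prog} (v : Node p) (x : ℕ) : Prop :=
  (x = 0 ∧ act v.2.1 v.2.2 = .halt) ∨ ∃ r,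
    (x = 4 * r + 1 ∧ act v.2.1 v.2.2 = .inc r) ∨ (x = 4 * r + 2 ∧ act v.2.1 v.2.2 = .dec r) ∨
    (x = 4 * r + 3 ∧ act v.2.1 v.2.2 = .zero r) ∨ (x = 4 * r + 4 ∧ act v.1.1 v.1.2 = .zero r)

theorem Node.lab_iff {p : Prog} (v : Node p) (r : ℕ) :
    (v.lab 0 ↔ act v.2.1 v.2.2 = .halt) ∧ (v.lab (4 * r + 1) ↔ act v.2.1 v.2.2 = .inc r) ∧
    (v.lab (4 * r + 2) ↔ act v.2.1 v.2.2 = .dec r) ∧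
    (v.lab (4 * r + 3) ↔ act v.2.1 v.2.2 = .zero r) ∧
    (v.lab (4 * r + 4) ↔ act v.1.1 v.1.2 = .zero r) := by
  refine ⟨?_, ?_, ?_, ?_, ?_⟩ <;> grind [Node.lab]

/-- The initial node. -/
def Node.start (p : Prog) : Node p := ((⟨[], .inl rfl⟩, true), (⟨[p], self_mem_ctrl p⟩, true))

/-- Only finitely many registers occur in a program. -/
theorem exists_register_bound (p : Prog) :
    ∃ R, ∀ u ∈ Ctrl p, ∀ b r, act u b = .inc r ∨ act u b = .dec r ∨ act u b = .zero r → r < R := by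
  have hfin : (⋃ v : Ctrl p × Bool, {r | act v.1 v.2 = .inc r ∨ act v.1 v.2 = .dec r ∨
      act v.1 v.2 = .zero r}).Finite := by
    refine Set.finite_iUnion fun v => Set.Subsingleton.finite fun r hr r' hr' => ?_
    simp only [Set.mem_ofPred_eq] at hr hr'
    rcases hr with h | h | h <;> simp_all
  obtain ⟨R, hR⟩ := hfin.bddAbove
  exact ⟨R + 1, fun u hu b r h =>
    Nat.lt_succ_of_le (hR (Set.mem_iUnion.2 ⟨(⟨u, hu⟩, b), h⟩))⟩

theorem stops_iff {p : Prog} {R : ℕ}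
    (hR : ∀ u ∈ Ctrl p, ∀ b r, act u b = .inc r ∨ act u b = .dec r ∨ act u b = .zero r → r < R)
    {ρ : ℕ → Node p} (h0 : ρ 0 = Node.start p) (hρ : ∀ i, Node.Edge (ρ i) (ρ (i + 1)))
    (s : ℕ → ℕ) (i : ℕ) :
    Stops (fun j => ((ρ j).2.1, (ρ j).2.2)) s i ↔
      0 < Nat.count (fun j => (ρ j).lab 0) i ∨ ∃ r < R,
        s r + Nat.count (fun j => (ρ j).lab (4 * r + 1)) i <
          Nat.count (fun j => (ρ j).lab (4 * r + 2)) i ∨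
        Nat.count (fun j => (ρ j).lab (4 * r + 4)) i <
          Nat.count (fun j => (ρ j).lab (4 * r + 3)) i ∧
        Nat.count (fun j => (ρ j).lab (4 * r + 2)) i <
          s r + Nat.count (fun j => (ρ j).lab (4 * r + 1)) i := by
  have hz : ∀ r, Nat.count (fun j => act (ρ j).1.1 (ρ j).1.2 = .zero r) i +
      (if ∃ j, i = j + 1 ∧ act (ρ j).2.1 (ρ j).2.2 = .zero r then 1 else 0) =
      Nat.count (fun j => act (ρ j).2.1 (ρ j).2.2 = .zero r) i := by
    intro r
    have hs : ∀ j, (∃ k, j = k + 1 ∧ act (ρ k).2.1 (ρ k).2.2 = .zero r) ↔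
        act (ρ j).1.1 (ρ j).1.2 = .zero r := by
      intro j
      cases j with
      | zero => simp [h0, Node.start, act]
      | succ j => simp [(hρ j).1]
    simp only [hs]
    induction i with
    | zero => rw [Nat.count_zero, Nat.count_zero]; simp [h0, Node.start, act]
    | succ i ih => rw [Nat.count_succ, ih, Nat.count_succ, (hρ i).1]
  have hpos : ∀ a, (∃ j < i, act (ρ j).2.1 (ρ j).2.2 = a) ↔
      0 < Nat.count (fun j => act (ρ j).2.1 (ρ j).2.2 = a) i := by
    intro a
    rw [Nat.count_eq_card_filter_range, Finset.card_pos]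
    simp [Finset.Nonempty]
  simp only [Stops, actAt, fun v : Node p => (v.lab_iff 0).1, fun (v : Node p) r => (v.lab_iff r).2.1,
    fun (v : Node p) r => (v.lab_iff r).2.2.1, fun (v : Node p) r => (v.lab_iff r).2.2.2.1,
    fun (v : Node p) r => (v.lab_iff r).2.2.2.2, hpos]
  refine or_congr Iff.rfl (exists_congr fun r => ?_)
  have hzr := hz r
  have hiff : (∃ j, i = j + 1 ∧ act (ρ j).2.1 (ρ j).2.2 = .zero r) ↔
      Nat.count (fun j => act (ρ j).1.1 (ρ j).1.2 = .zero r) i <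
        Nat.count (fun j => act (ρ j).2.1 (ρ j).2.2 = .zero r) i := by
    split_ifs at hzr with h
    · exact ⟨fun _ => by omega, fun _ => h⟩
    · exact ⟨fun h' => absurd h' h, fun _ => by omega⟩
  rw [hiff]
  refine ⟨fun h => ⟨?_, h⟩, And.right⟩
  rcases h with h | h
  · obtain ⟨j, -, hj⟩ := (hpos _).2 (Nat.zero_lt_of_lt h)
    exact hR _ (ρ j).2.1.2 _ r (.inr (.inl hj))
  · obtain ⟨j, -, hj⟩ := (hpos _).2 (Nat.zero_lt_of_lt h.1)
    exact hR _ (ρ j).2.1.2 _ r (.inr (.inr hj))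

/-- Termination of a program reduces to model checking over a fixed Kripke structure. -/
theorem exists_sat_iff_halts {p : Prog} (hp : ∀ s, honest [p] s = true) :
    ∃ (M : FinKS) (hM : M.Total) (q : Fin M.n) (R : ℕ),
      ∀ s, sat (M.toKripke hM) (.stops s R) q ↔ Halts p s := by
  obtain ⟨R, hR⟩ := exists_register_bound p
  obtain ⟨M, hM, e, hE, hlab⟩ := exists_finKS (V := Node p) Node.Edge Node.edge_total Node.lab
    (4 * R + 1)
  refine ⟨M, hM, e.symm (Node.start p), R, fun s => ?_⟩
  rw [sat_stops, halts_iff_forall_isGuess hp]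
  have hcount : ∀ (ρ : ℕ → Fin M.n) (x i : ℕ), x < 4 * R + 1 →
      countSat ((M.toKripke hM).label · x) (runPrefix ρ i) =
        Nat.count (fun j => (e (ρ j)).lab x) i := by
    intro ρ x i hx
    rw [countSat_runPrefix]
    simp only [hlab _ x hx]
  have key : ∀ ρ : ℕ → Fin M.n, (M.toKripke hM).Run ρ → ρ 0 = e.symm (Node.start p) → ∀ i,
      (csat (M.toKripke hM) (.stops s R) (runPrefix ρ i) ↔
        Stops (fun j => ((e (ρ j)).2.1, (e (ρ j)).2.2)) s i) := by
    intro ρ hρ h0 i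
    rw [csat_stops, stops_iff hR (ρ := fun j => e (ρ j)) (by simp [h0])
      (fun i => (hE _ _).1 (hρ i)), hcount ρ 0 i (by omega)]
    refine or_congr Iff.rfl (exists_congr fun r => and_congr_right fun hr => ?_)
    rw [hcount ρ _ i (by omega), hcount ρ _ i (by omega), hcount ρ _ i (by omega),
      hcount ρ _ i (by omega)]
  constructor
  · intro h y hy
    let z : ℕ → Ctrl p × Bool := fun i => (⟨(y i).1, hy.mem_ctrl i⟩, (y i).2)
    let ρ : ℕ → Node p := fun i => (Nat.casesOn i (Node.start p).1 z, z i)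
    have hρ : (M.toKripke hM).Run fun i => e.symm (ρ i) := fun i => by
      rw [hE, e.apply_symm_apply, e.apply_symm_apply]
      exact ⟨rfl, hy.2 i⟩
    have h0 : ρ 0 = Node.start p := by
      simp [ρ, z, Node.start, hy.1]
    obtain ⟨i, hi⟩ := h _ hρ (congrArg _ h0)
    rw [key _ hρ (congrArg _ h0)] at hi
    refine ⟨i, ?_⟩
    simpa [ρ, z] using hi
  · intro h ρ hρ h0
    obtain ⟨i, hi⟩ := h (fun j => ((e (ρ j)).2.1, (e (ρ j)).2.2))
      ⟨by simp [h0, Node.start], fun i => ((hE _ _).1 (hρ i)).2⟩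
    exact ⟨i, (key ρ hρ h0 i).2 hi⟩

end Prog

/-- model checking CCTLb±1 is undecidable: no computable
function decides, with respect to the natural encoding, whether
`q ⊨_S Φ` for finite Kripke structures `S` and CCTLb±1 formulas `Φ`. -/
theorem cctlb_pm_mc_undecidable :
    ¬ ∃ f : ℕ → Bool, Computable f ∧
      ∀ (M : FinKS) (hM : M.Total) (q : Fin M.n) (Φ : CForm), Φ.PM →
        (f (encTriple M (q : ℕ) Φ) = true ↔ sat (M.toKripke hM) Φ q) := by
  rintro ⟨f, hf, h⟩
  have hg : Primrec₂ fun m k : ℕ =>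
      if (Nat.Partrec.Code.evaln k (Denumerable.ofNat Nat.Partrec.Code m) 0).isSome then 0 else 1 := by
    refine Primrec.ite (c := fun x : ℕ × ℕ => (Nat.Partrec.Code.evaln x.2
      (Denumerable.ofNat Nat.Partrec.Code x.1) 0).isSome = true) ?_ (.const 0) (.const 1)
    exact PrimrecRel.comp Primrec.eq (Primrec.option_isSome.comp (Nat.Partrec.Code.primrec_evaln.comp
      ((Primrec.snd.pair ((Primrec.ofNat _).comp Primrec.fst)).pair (.const 0)))) (.const true)
  obtain ⟨p, hp, hhalt⟩ := Prog.exists_halts_iff hg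
  obtain ⟨M, hM, q, R, hsat⟩ := Prog.exists_sat_iff_halts hp
  refine ComputablePred.halting_problem 0 ?_
  have hiff : ∀ c : Nat.Partrec.Code, (c.eval 0).Dom ↔
      f (encTriple M q (.stops (Function.update 0 0 (Encodable.encode c)) R)) = true := by
    intro c
    rw [h M hM q _ (CForm.stops_pm _ _), hsat, hhalt]
    simp only [Denumerable.ofNat_encode, ite_eq_left_iff, one_ne_zero, imp_false, not_not]
    constructor
    · intro hd
      obtain ⟨k, hk⟩ := Nat.Partrec.Code.evaln_complete.1 (Part.get_mem hd)
      exact ⟨k, Option.isSome_iff_exists.2 ⟨_, hk⟩⟩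
    · rintro ⟨k, hk⟩
      obtain ⟨x, hx⟩ := Option.isSome_iff_exists.1 hk
      exact (Nat.Partrec.Code.evaln_sound hx).1
  refine ComputablePred.computable_iff.2 ⟨fun c => f (encTriple M q
    (.stops (Function.update 0 0 (Encodable.encode c)) R)),
    hf.comp ((computable_encTriple_stops M q R).comp Computable.encode), ?_⟩
  funext c
  exact propext (hiff c)
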